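/- If a stochastic transition system (S, Σ, κ) admits a finite attractor A (a finite set all of whose subsets are measurable, such that P_μ(F A) = 1 for every initial distribution μ), then the STS is decisive with respect to every measurable set B ∈ Σ. -/

import Mathlib

open MeasureTheory ProbabilityTheory Filter Set Topology

/-- Prepend one state to an infinite run. -/
def prep {S : Type*} (s : S) (ρ : ℕ → S) : ℕ → S
  | 0 => s
  | n + 1 => ρ n

/-- Prepend a finite word to an infinite run. -/
def prepList {S : Type*} (l : List S) (ρ : ℕ → S) : ℕ → S := fun n =>
  if h : n < l.length then l.get ⟨n, h⟩ else ρ (n - l.length)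

/-- `E` is a tail event: membership is not affected by changing a finite prefix. -/
def IsTailEvent {S : Type*} (E : Set (ℕ → S)) : Prop :=
  ∀ (l : List S) (ρ : ℕ → S), ρ ∈ E ↔ prepList l ρ ∈ E

/-- Cylinder `Cyl A n = {ρ | ρ k ∈ A k for all k < n}` (built from `A 0, …, A (n-1)`). -/
def Cyl {S : Type*} (A : ℕ → Set S) (n : ℕ) : Set (ℕ → S) := {ρ | ∀ k < n, ρ k ∈ A k}

/-- Event `F B`: eventually reach `B`. -/
def FEv {S : Type*} (B : Set S) : Set (ℕ → S) := {ρ | ∃ n, ρ n ∈ B}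

/-- Event `F^{≤ m} B`: reach `B` within `m` steps. -/
def FleEv {S : Type*} (m : ℕ) (B : Set S) : Set (ℕ → S) := {ρ | ∃ n ≤ m, ρ n ∈ B}

/-- Event `G B`: always in `B`. -/
def GEv {S : Type*} (B : Set S) : Set (ℕ → S) := {ρ | ∀ n, ρ n ∈ B}

/-- Event `GF B`: visit `B` infinitely often. -/
def GFEv {S : Type*} (B : Set S) : Set (ℕ → S) := {ρ | ∀ i, ∃ j ≥ i, ρ j ∈ B}

/-- Event `FG B`: eventually always in `B`. -/
def FGEv {S : Type*} (B : Set S) : Set (ℕ → S) := {ρ | ∃ i, ∀ j ≥ i, ρ j ∈ B}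

/-- Event `GF φ_𝒜`: the pattern `A 0, …, A n` occurs at infinitely many positions. -/
def GFPat {S : Type*} (A : ℕ → Set S) (n : ℕ) : Set (ℕ → S) :=
  {ρ | ∀ i, ∃ j ≥ i, ∀ k ≤ n, ρ (j + k) ∈ A k}

/-- Event `A U B`. -/
def UntilEv {S : Type*} (A B : Set S) : Set (ℕ → S) :=
  {ρ | ∃ n, ρ n ∈ B ∧ ∀ k < n, ρ k ∈ A}

/-- Event `A U^{≤ m} B`. -/
def UntilLeEv {S : Type*} (m : ℕ) (A B : Set S) : Set (ℕ → S) :=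
  {ρ | ∃ n ≤ m, ρ n ∈ B ∧ ∀ k < n, ρ k ∈ A}

/-- The filtration `F n`: σ-algebra generated by the cylinders of length `n`,
i.e., by the first `n` coordinates. -/
def cylFiltration (S : Type*) [MeasurableSpace S] (n : ℕ) : MeasurableSpace (ℕ → S) :=
  MeasurableSpace.comap (fun ρ (i : Fin n) => ρ i) inferInstance

/-- `P` is the family of path measures of the STS `(S, Σ, κ)` given by the
Ionescu–Tulcea construction: for every initial probability distribution `μ`,
`P μ` is a probability measure on runs, and `P` satisfies the Markov property
(`s₀ ∼ μ`, and the rest of the run follows the chain started in `κ s₀`),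
which uniquely characterizes the Ionescu–Tulcea path measures. -/
def IsPathMeasure {S : Type*} [MeasurableSpace S] (κ : Kernel S S)
    (P : Measure S → Measure (ℕ → S)) : Prop :=
  (∀ μ : Measure S, IsProbabilityMeasure μ → IsProbabilityMeasure (P μ)) ∧
  (∀ μ : Measure S, IsProbabilityMeasure μ →
    P μ = μ.bind fun s => (P (κ s)).map (prep s))

/-- `B̃`: the set of states from which `B` is reached with probability zero. -/
def Btilde {S : Type*} [MeasurableSpace S] (P : Measure S → Measure (ℕ → S)) (B : Set S) :
    Set S := {s | P (Measure.dirac s) (FEv B) = 0}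

/-- The STS with path measures `P` is decisive w.r.t. `B`. -/
def Decisive {S : Type*} [MeasurableSpace S] (P : Measure S → Measure (ℕ → S)) (B : Set S) :
    Prop := ∀ μ : Measure S, IsProbabilityMeasure μ → P μ (FEv B ∪ FEv (Btilde P B)) = 1

/-- `ν_{A₀,…,Aₙ}`: the distribution of the `n`-th state under `P ν` conditioned on
the cylinder `Cyl A (n+1)`. -/
noncomputable def condDist {S : Type*} [MeasurableSpace S]
    (P : Measure S → Measure (ℕ → S)) (ν : Measure S) (A : ℕ → Set S) (n : ℕ) : Measure S :=
  (ProbabilityTheory.cond (P ν) (Cyl A (n + 1))).map fun ρ => ρ n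

lemma measurable_prep {S : Type*} [MeasurableSpace S] (s : S) : Measurable (prep s) := by
  refine measurable_pi_lambda _ fun n => ?_
  cases n with
  | zero => exact measurable_const
  | succ k => exact measurable_pi_apply k

lemma measurableSet_GEv {S : Type*} [MeasurableSpace S] {D : Set S} (hD : MeasurableSet D) :
    MeasurableSet (GEv D) := by
  rw [GEv, ofPred_forall]
  exact MeasurableSet.iInter fun n => measurable_pi_apply n hD

lemma measurableSet_Cyl {S : Type*} [MeasurableSpace S] {A : ℕ → Set S}
    (hA : ∀ n, MeasurableSet (A n)) (n : ℕ) : MeasurableSet (Cyl A n) := by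
  simp only [Cyl, ofPred_forall]
  exact MeasurableSet.iInter fun k => MeasurableSet.iInter fun _ => measurable_pi_apply k (hA k)

lemma compl_FEv {S : Type*} (B : Set S) : (FEv B)ᶜ = GEv Bᶜ := by
  ext ρ
  simp [FEv, GEv]

lemma measurableSet_FEv {S : Type*} [MeasurableSpace S] {B : Set S} (hB : MeasurableSet B) :
    MeasurableSet (FEv B) := by
  rw [← MeasurableSet.compl_iff, compl_FEv]
  exact measurableSet_GEv hB.compl

lemma prep_preimage_GEv_subset {S : Type*} (D : Set S) (s : S) :
    prep s ⁻¹' GEv D ⊆ GEv D := fun _ hρ n => hρ (n + 1)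

lemma prep_preimage_GEv_of_notMem {S : Type*} {D : Set S} {s : S} (hs : s ∉ D) :
    prep s ⁻¹' GEv D = ∅ :=
  eq_empty_of_forall_notMem fun _ hρ => hs (hρ 0)

lemma prep_preimage_Cyl_succ {S : Type*} {X : Set S} {s : S} (hs : s ∈ X) (n : ℕ) :
    prep s ⁻¹' Cyl (fun _ => X) (n + 1) = Cyl (fun _ => X) n := by
  ext ρ
  refine ⟨fun h k hk => h (k + 1) (by omega), fun h k hk => ?_⟩
  cases k with
  | zero => exact hs
  | succ k => exact h k (by omega)

lemma tendsto_measure_Cyl {S : Type*} [MeasurableSpace S] {X : Set S} (hX : MeasurableSet X)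
    (m : Measure (ℕ → S)) [IsFiniteMeasure m] :
    Tendsto (fun n => m (Cyl (fun _ => X) n)) atTop (𝓝 (m (GEv X))) := by
  have h : GEv X = ⋂ n, Cyl (fun _ => X) n := by
    ext ρ
    simp only [GEv, Cyl, mem_iInter, mem_ofPred_eq]
    exact ⟨fun h _ k _ => h k, fun h n => h (n + 1) n n.lt_succ_self⟩
  rw [h]
  exact tendsto_measure_iInter_atTop
    (fun n => (measurableSet_Cyl (fun _ => hX) n).nullMeasurableSet)
    (fun _ _ hij _ hρ k hk => hρ k (hk.trans_le hij)) ⟨0, measure_ne_top _ _⟩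

namespace IsPathMeasure

variable {S : Type*} [MeasurableSpace S] {κ : Kernel S S} {P : Measure S → Measure (ℕ → S)}

/-- The one-step kernel is a.e.-measurable, since otherwise `Measure.bind` would be zero. -/
lemma aemeasurable (hP : IsPathMeasure κ P) (μ : Measure S) [hμ : IsProbabilityMeasure μ] :
    AEMeasurable (fun s => (P (κ s)).map (prep s)) μ := by
  by_contra h
  have h0 := hP.2 μ hμ
  rw [Measure.bind, Measure.map_of_not_aemeasurable h, Measure.join_zero] at h0
  have := hP.1 μ hμ
  exact IsProbabilityMeasure.ne_zero (P μ) h0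

lemma apply_eq_lintegral (hP : IsPathMeasure κ P) (μ : Measure S) [hμ : IsProbabilityMeasure μ]
    {E : Set (ℕ → S)} (hE : MeasurableSet E) :
    P μ E = ∫⁻ s, P (κ s) (prep s ⁻¹' E) ∂μ := by
  rw [hP.2 μ hμ, Measure.bind_apply hE (hP.aemeasurable μ)]
  exact lintegral_congr fun s => Measure.map_apply (measurable_prep s) hE

lemma dirac_apply (hP : IsPathMeasure κ P) {a : S} (ha : MeasurableSet {a})
    {E : Set (ℕ → S)} (hE : MeasurableSet E) :
    P (Measure.dirac a) E = P (κ a) (prep a ⁻¹' E) := by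
  rw [hP.apply_eq_lintegral _ hE]
  have h : ∀ᵐ s ∂Measure.dirac a, s = a := (ae_dirac_iff (p := fun s => s = a) ha).2 rfl
  rw [lintegral_congr_ae (g := fun _ => P (κ a) (prep a ⁻¹' E))
    (h.mono fun s hs => by simp only [hs])]
  simp

/-- If `A` is almost surely reached, then the probability of staying in `D` forever is at most
its maximal value over initial states in `A`. -/
lemma GEv_le_of_attractor [IsMarkovKernel κ] (hP : IsPathMeasure κ P) {A D : Set S}
    (hA : MeasurableSet A) (hD : MeasurableSet D) {M : ENNReal}
    (hM : ∀ a ∈ A, P (κ a) (prep a ⁻¹' GEv D) ≤ M)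
    (hattr : ∀ μ : Measure S, IsProbabilityMeasure μ → P μ (FEv A) = 1)
    (μ : Measure S) [hμ : IsProbabilityMeasure μ] : P μ (GEv D) ≤ M := by
  have key (n : ℕ) : ∀ μ : Measure S, IsProbabilityMeasure μ →
      P μ (GEv D) ≤ M + P μ (Cyl (fun _ => Aᶜ) n) := by
    induction n with
    | zero =>
      intro μ hμ
      have := hP.1 μ hμ
      exact (measure_mono fun _ _ k hk => absurd hk k.not_lt_zero).trans le_add_self
    | succ n ih =>
      intro μ hμ
      rw [hP.apply_eq_lintegral μ (measurableSet_GEv hD),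
        hP.apply_eq_lintegral μ (measurableSet_Cyl (fun _ => hA.compl) (n + 1))]
      calc ∫⁻ s, P (κ s) (prep s ⁻¹' GEv D) ∂μ
          ≤ ∫⁻ s, (M + P (κ s) (prep s ⁻¹' Cyl (fun _ => Aᶜ) (n + 1))) ∂μ := by
            refine lintegral_mono fun s => ?_
            by_cases hs : s ∈ A
            · exact (hM s hs).trans le_self_add
            · rw [prep_preimage_Cyl_succ (X := Aᶜ) hs]
              exact (measure_mono (prep_preimage_GEv_subset D s)).trans (ih (κ s) inferInstance)
        _ = M + ∫⁻ s, P (κ s) (prep s ⁻¹' Cyl (fun _ => Aᶜ) (n + 1)) ∂μ := by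
            rw [lintegral_add_left measurable_const]
            simp
  have := hP.1 μ hμ
  have hnull : P μ (GEv Aᶜ) = 0 := by
    rw [← compl_FEv, prob_compl_eq_zero_iff (measurableSet_FEv hA)]
    exact hattr μ hμ
  have hlim := (tendsto_measure_Cyl hA.compl (P μ)).const_add M
  rw [hnull, add_zero] at hlim
  exact ge_of_tendsto' hlim fun n => key n μ hμ

/-- A uniform bound on the probability of staying in `D` forever improves by the factor
`P μ (GEv X)` for any `X ⊇ D`. -/
lemma GEv_le_mul [IsMarkovKernel κ] (hP : IsPathMeasure κ P) {D X : Set S}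
    (hD : MeasurableSet D) (hX : MeasurableSet X) (hDX : D ⊆ X) {M : ENNReal} (hM_top : M ≠ ⊤)
    (hM : ∀ μ : Measure S, IsProbabilityMeasure μ → P μ (GEv D) ≤ M)
    (μ : Measure S) [hμ : IsProbabilityMeasure μ] : P μ (GEv D) ≤ M * P μ (GEv X) := by
  have key (n : ℕ) : ∀ μ : Measure S, IsProbabilityMeasure μ →
      P μ (GEv D) ≤ M * P μ (Cyl (fun _ => X) n) := by
    induction n with
    | zero =>
      intro μ hμ
      have := hP.1 μ hμ
      have h : Cyl (fun _ : ℕ => X) 0 = univ := by simp [Cyl]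
      simpa [h] using hM μ hμ
    | succ n ih =>
      intro μ hμ
      rw [hP.apply_eq_lintegral μ (measurableSet_GEv hD),
        hP.apply_eq_lintegral μ (measurableSet_Cyl (fun _ => hX) (n + 1)),
        ← lintegral_const_mul' _ _ hM_top]
      refine lintegral_mono fun s => ?_
      by_cases hs : s ∈ X
      · rw [prep_preimage_Cyl_succ hs]
        exact (measure_mono (prep_preimage_GEv_subset D s)).trans (ih (κ s) inferInstance)
      · simp [prep_preimage_GEv_of_notMem fun h => hs (hDX h)]
  have := hP.1 μ hμ
  exact ge_of_tendsto'
    (ENNReal.Tendsto.const_mul (tendsto_measure_Cyl hX (P μ)) (Or.inr hM_top))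
    fun n => key n μ hμ

end IsPathMeasure

/-- If an STS admits a finite attractor `A` (a finite set all of whose subsets are
measurable and which is almost surely reached from every initial distribution), then
the STS is decisive with respect to every measurable set `B`. -/
theorem finite_attractor_decisive
    {S : Type*} [MeasurableSpace S] (κ : Kernel S S) [IsMarkovKernel κ]
    (P : Measure S → Measure (ℕ → S)) (hP : IsPathMeasure κ P)
    (A : Set S) (hAfin : A.Finite) (hAmeas : ∀ C ⊆ A, MeasurableSet C)
    (hattr : ∀ μ : Measure S, IsProbabilityMeasure μ → P μ (FEv A) = 1) :
    ∀ B : Set S, MeasurableSet B → Decisive P B := by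
  intro B hB μ hμ
  have hC : MeasurableSet (A ∩ Btilde P B) := hAmeas _ inter_subset_left
  have hA : MeasurableSet A := hAmeas A subset_rfl
  set D : Set S := (B ∪ A ∩ Btilde P B)ᶜ with hD_def
  have hD : MeasurableSet D := (hB.union hC).compl
  have hDB : D ⊆ Bᶜ := compl_subset_compl.2 subset_union_left
  let h : S → ENNReal := fun a => P (κ a) (prep a ⁻¹' GEv D)
  have h_zero : ∀ a ∈ A, (∀ a' ∈ A, h a' ≤ h a) → h a = 0 := by
    intro a ha hmax
    by_cases haD : a ∈ D
    · have hsing : MeasurableSet {a} := hAmeas _ (singleton_subset_iff.2 ha)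
      have := hP.1 (κ a) inferInstance
      have := hP.1 (Measure.dirac a) inferInstance
      have h_top : h a ≠ ⊤ := measure_ne_top _ _
      have hle := hP.GEv_le_mul hD hB.compl hDB h_top
        (fun ν _ => hP.GEv_le_of_attractor hA hD hmax hattr ν) (Measure.dirac a)
      rw [hP.dirac_apply hsing (measurableSet_GEv hD)] at hle
      by_contra h_ne
      have hone : 1 ≤ P (Measure.dirac a) (GEv Bᶜ) := by
        refine (ENNReal.mul_le_mul_iff_right h_ne h_top).1 ?_
        rw [mul_one]
        exact hle
      have hzero : P (Measure.dirac a) (FEv B) = 0 := by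
        rw [← compl_compl (FEv B), compl_FEv,
          prob_compl_eq_zero_iff (measurableSet_GEv hB.compl)]
        exact le_antisymm prob_le_one hone
      exact haD (Or.inr ⟨ha, hzero⟩)
    · simp [h, prep_preimage_GEv_of_notMem haD]
  have h_le : ∀ a ∈ A, h a ≤ 0 := by
    intro a ha
    obtain ⟨b, hb, hmax⟩ := exists_max_image A h hAfin ⟨a, ha⟩
    exact (hmax a ha).trans (h_zero b hb hmax).le
  have hnull : P μ (GEv D) = 0 := nonpos_iff_eq_zero.1
    (hP.GEv_le_of_attractor hA hD h_le hattr μ)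
  have := hP.1 μ hμ
  rw [hD_def, ← compl_FEv, prob_compl_eq_zero_iff (measurableSet_FEv (hB.union hC))] at hnull
  refine le_antisymm prob_le_one (hnull.symm.le.trans (measure_mono ?_))
  rintro ρ ⟨n, hn | hn⟩
  · exact Or.inl ⟨n, hn⟩
  · exact Or.inr ⟨n, hn.2⟩
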